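/- arXiv:2405.07254 — 2 statements merged into one kernel-verified Lean document; each statement's English description precedes it below -/
import Mathlib

section
/- For all matrices X, Y ∈ Mat(n,K), all upper unitriangular matrices g₁, g₂, g₃ ∈ UT(n), and every pair (i,k) with i' < k, one has P_{ik}(g₁ X g₂⁻¹, g₂ Y g₃⁻¹) = P_{ik}(X,Y). -/
open Matrix

/-- Entry of an `n × n` matrix in 1-based indexing; `0` outside the range `[1,n]²`. -/
def ent {R : Type*} [Zero R] {n : ℕ} (X : Matrix (Fin n) (Fin n) R) (a b : ℕ) : R :=
  if h : 1 ≤ a ∧ a ≤ n ∧ 1 ≤ b ∧ b ≤ n then X ⟨a - 1, by omega⟩ ⟨b - 1, by omega⟩ else 0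

/-- `Dmin k X`: the left lower corner minor of order `n - k + 1`;
rows `k,…,n`, columns `1,…,n-k+1` (1-based). -/
noncomputable def Dmin {R : Type*} [CommRing R] {n : ℕ} (k : ℕ)
    (X : Matrix (Fin n) (Fin n) R) : R :=
  (Matrix.of fun r c : Fin (n + 1 - k) => ent X (k + r.val) (1 + c.val)).det

/-- `Mmin i j X`: minor of order `n - i + 1` with rows `i,…,n` and
columns `1,…,n-i` together with column `j` (1-based). -/
noncomputable def Mmin {R : Type*} [CommRing R] {n : ℕ} (i j : ℕ)
    (X : Matrix (Fin n) (Fin n) R) : R :=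
  (Matrix.of fun r c : Fin (n + 1 - i) =>
    ent X (i + r.val) (if c.val < n - i then 1 + c.val else j)).det

/-- `Nmin j k Y`: minor of order `n - k + 1` with rows `{j} ∪ {k+1,…,n}` and
columns `1,…,n-k+1` (1-based). -/
noncomputable def Nmin {R : Type*} [CommRing R] {n : ℕ} (j k : ℕ)
    (Y : Matrix (Fin n) (Fin n) R) : R :=
  (Matrix.of fun r c : Fin (n + 1 - k) =>
    ent Y (if r.val = 0 then j else k + r.val) (1 + c.val)).det

/-- `Pmin i k X Y = Σ_{j=i'}^{k} M_{ij}(X) N_{jk}(Y)`, where `i' = n - i + 1`. -/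
noncomputable def Pmin {R : Type*} [CommRing R] {n : ℕ} (i k : ℕ)
    (X Y : Matrix (Fin n) (Fin n) R) : R :=
  ∑ j ∈ Finset.Icc (n + 1 - i) k, Mmin i j X * Nmin j k Y

/-- `Rminus i k X Y`: determinant of the `k × k` matrix whose first `n - i + 1` rows are
rows `i,…,n` of `X` restricted to columns `1,…,k`, and whose remaining rows are the last
`k - (n - i + 1)` rows of `Y` restricted to columns `1,…,k`. -/
noncomputable def Rminus {R : Type*} [CommRing R] {n : ℕ} (i k : ℕ)
    (X Y : Matrix (Fin n) (Fin n) R) : R :=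
  (Matrix.of fun r c : Fin k =>
    if r.val < n + 1 - i then ent X (i + r.val) (1 + c.val)
    else ent Y (n - k + 1 + r.val) (1 + c.val)).det

/-- `Rplus i k Z X`: determinant of the `(n-i+1) × (n-i+1)` matrix whose first
`(n-i+1) - k` columns are columns `1,…,(n-i+1)-k` of `Z` restricted to rows `i,…,n`,
and whose last `k` columns are columns `1,…,k` of `X` restricted to rows `i,…,n`. -/
noncomputable def Rplus {R : Type*} [CommRing R] {n : ℕ} (i k : ℕ)
    (Z X : Matrix (Fin n) (Fin n) R) : R :=
  (Matrix.of fun r c : Fin (n + 1 - i) =>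
    if c.val < n + 1 - i - k then ent Z (i + r.val) (1 + c.val)
    else ent X (i + r.val) (c.val - (n + 1 - i - k) + 1)).det

/-- Square minor of order `m` with rows `r₀, r₀+1, …` and columns `c₀, c₀+1, …` (1-based). -/
noncomputable def RectMinor {R : Type*} [CommRing R] {n : ℕ} (r₀ c₀ m : ℕ)
    (X : Matrix (Fin n) (Fin n) R) : R :=
  (Matrix.of fun r c : Fin m => ent X (r₀ + r.val) (c₀ + c.val)).det

/-- `u` is upper triangular with ones on the diagonal. -/
def IsUT {R : Type*} [CommRing R] {n : ℕ} (u : Matrix (Fin n) (Fin n) R) : Prop :=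
  (∀ i, u i i = 1) ∧ ∀ i j : Fin n, (j : ℕ) < (i : ℕ) → u i j = 0

/-- Anti-diagonal matrix: entries off the anti-diagonal vanish (0-based: `a + b = n - 1`). -/
def AntiDiag {R : Type*} [Zero R] {n : ℕ} (X : Matrix (Fin n) (Fin n) R) : Prop :=
  ∀ a b : Fin n, (a : ℕ) + (b : ℕ) ≠ n - 1 → X a b = 0

/-- Lower anti-triangular: entries above the anti-diagonal vanish. -/
def LowerAnti {R : Type*} [Zero R] {n : ℕ} (X : Matrix (Fin n) (Fin n) R) : Prop :=
  ∀ a b : Fin n, (a : ℕ) + (b : ℕ) < n - 1 → X a b = 0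

/-- Upper anti-triangular: entries below the anti-diagonal vanish. -/
def UpperAnti {R : Type*} [Zero R] {n : ℕ} (X : Matrix (Fin n) (Fin n) R) : Prop :=
  ∀ a b : Fin n, n - 1 < (a : ℕ) + (b : ℕ) → X a b = 0

theorem IsUT.ent_self {R : Type*} [CommRing R] {n : ℕ} {u : Matrix (Fin n) (Fin n) R}
    (hu : IsUT u) {p : ℕ} (h1 : 1 ≤ p) (h2 : p ≤ n) : ent u p p = 1 := by
  rw [ent, dif_pos ⟨h1, h2, h1, h2⟩, hu.1]

theorem IsUT.ent_eq_zero {R : Type*} [CommRing R] {n : ℕ} {u : Matrix (Fin n) (Fin n) R}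
    (hu : IsUT u) {p q : ℕ} (h : q < p) : ent u p q = 0 := by
  unfold ent
  split_ifs with hpq
  · exact hu.2 _ _ (by simp only; omega)
  · rfl

theorem IsUT.det_eq_one {R : Type*} [CommRing R] {n : ℕ} {u : Matrix (Fin n) (Fin n) R}
    (hu : IsUT u) : u.det = 1 := by
  rw [Matrix.det_of_isUpperTriangular fun i j h => hu.2 i j h]
  exact Finset.prod_eq_one fun i _ => hu.1 i

theorem ent_mul {R : Type*} [CommRing R] {n : ℕ} (A B : Matrix (Fin n) (Fin n) R) (p q : ℕ) :
    ent (A * B) p q = ∑ l ∈ Finset.Ico 1 (n + 1), ent A p l * ent B l q := by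
  rw [Finset.sum_Ico_eq_sum_range, Nat.add_sub_cancel, Finset.sum_range]
  by_cases h : 1 ≤ p ∧ p ≤ n ∧ 1 ≤ q ∧ q ≤ n
  · rw [ent, dif_pos h, Matrix.mul_apply]
    refine Finset.sum_congr rfl fun l _ => ?_
    rw [ent, ent, dif_pos (by omega), dif_pos (by omega)]
    simp
  · rw [ent, dif_neg h]
    refine (Finset.sum_eq_zero fun l _ => ?_).symm
    by_cases hp : 1 ≤ p ∧ p ≤ n
    · have : ent B (1 + l) q = 0 := dif_neg (by omega)
      rw [this, mul_zero]
    · have : ent A p (1 + l) = 0 := dif_neg (by omega)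
      rw [this, zero_mul]

theorem Mmin_unitriangular_mul {R : Type*} [CommRing R] {n : ℕ} {u : Matrix (Fin n) (Fin n) R}
    (hu : IsUT u) {i : ℕ} (hi : 1 ≤ i) (j : ℕ) (X : Matrix (Fin n) (Fin n) R) :
    Mmin i j (u * X) = Mmin i j X := by
  let B : Matrix (Fin (n + 1 - i)) (Fin (n + 1 - i)) R :=
    Matrix.of fun r s => ent u (i + r.val) (i + s.val)
  have hB : B.det = 1 := by
    refine IsUT.det_eq_one ⟨fun r => hu.ent_self (by omega) (by omega), fun r s h => ?_⟩
    exact hu.ent_eq_zero (by omega)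
  unfold Mmin
  rw [← one_mul (Matrix.det (Matrix.of fun r c : Fin (n + 1 - i) => ent X _ _)), ← hB,
    ← Matrix.det_mul]
  congr 1
  ext r c
  rw [Matrix.mul_apply, Matrix.of_apply, ent_mul]
  simp only [B, Matrix.of_apply]
  generalize (if c.val < n - i then 1 + c.val else j) = q
  rw [← Finset.sum_range fun s => ent u (i + r.val) (i + s) * ent X (i + s) q,
    ← Finset.sum_Ico_eq_sum_range (fun l => ent u (i + r.val) l * ent X l q)]
  symm
  refine Finset.sum_subset (Finset.Ico_subset_Ico hi le_rfl) fun l hl hl' => ?_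
  rw [Finset.mem_Ico] at hl hl'
  rw [hu.ent_eq_zero (by omega), zero_mul]

theorem Mmin_eq_det_updateCol {R : Type*} [CommRing R] {n i : ℕ} (hi : i ≤ n) (j : ℕ)
    (X : Matrix (Fin n) (Fin n) R) :
    Mmin i j X = ((Matrix.of fun r c : Fin (n + 1 - i) => ent X (i + r.val) (1 + c.val)).updateCol
      ⟨n - i, by omega⟩ fun r => ent X (i + r.val) j).det := by
  unfold Mmin
  congr 1
  ext r c
  rw [Matrix.updateCol_apply, Matrix.of_apply, Matrix.of_apply]
  by_cases h : c.val < n - i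
  · rw [if_pos h, if_neg (by rw [Fin.ext_iff]; simp only; omega)]
  · rw [if_neg h, if_pos (by rw [Fin.ext_iff]; simp only; omega)]

/-- A unitriangular column operation does not change a minor on the first columns and one
further, arbitrary column. -/
theorem det_updateCol_mul_unitriangular {R : Type*} [CommRing R] {n i : ℕ}
    {u : Matrix (Fin n) (Fin n) R} (hu : IsUT u) (hi1 : 1 ≤ i) (hi : i ≤ n)
    (X : Matrix (Fin n) (Fin n) R) (v : Fin (n + 1 - i) → R) :
    ((Matrix.of fun r c : Fin (n + 1 - i) => ent (X * u) (i + r.val) (1 + c.val)).updateCol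
      ⟨n - i, by omega⟩ v).det =
    ((Matrix.of fun r c : Fin (n + 1 - i) => ent X (i + r.val) (1 + c.val)).updateCol
      ⟨n - i, by omega⟩ v).det := by
  let last : Fin (n + 1 - i) := ⟨n - i, by omega⟩
  let B : Matrix (Fin (n + 1 - i)) (Fin (n + 1 - i)) R :=
    (Matrix.of fun s c => ent u (1 + s.val) (1 + c.val)).updateCol last (Pi.single last 1)
  have hB : B.det = 1 := by
    refine IsUT.det_eq_one ⟨fun s => ?_, fun s c h => ?_⟩
    · by_cases hs : s = last
      · simp [B, hs]
      · simp only [B, Matrix.updateCol_ne hs, Matrix.of_apply]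
        exact hu.ent_self (by omega) (by omega)
    · have hc : c ≠ last := by
        rw [Ne, Fin.ext_iff]; simp only [last]; omega
      simp only [B, Matrix.updateCol_ne hc, Matrix.of_apply]
      exact hu.ent_eq_zero (by omega)
  rw [← mul_one (Matrix.det (Matrix.updateCol (Matrix.of fun r c => ent X _ _) _ _)), ← hB,
    ← Matrix.det_mul]
  congr 1
  ext r c
  rw [Matrix.mul_apply]
  by_cases hc : c = last
  · subst hc
    simp [B, last, Pi.single_apply]
  · have hc' : c.val < n - i := by
      rw [Fin.ext_iff] at hc; simp only [last] at hc; omega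
    simp only [B, Matrix.updateCol_ne hc, Matrix.of_apply]
    rw [Matrix.updateCol_ne hc, Matrix.of_apply, ent_mul]
    have hF : ∀ s : Fin (n + 1 - i),
        (Matrix.updateCol (Matrix.of fun r c : Fin (n + 1 - i) => ent X (i + r.val) (1 + c.val))
          last v) r s * ent u (1 + s.val) (1 + c.val) =
        ent X (i + r.val) (1 + s.val) * ent u (1 + s.val) (1 + c.val) := by
      intro s
      by_cases hs : s = last
      · rw [hu.ent_eq_zero, mul_zero, mul_zero]
        rw [hs]; simp only [last]; omega
      · rw [Matrix.updateCol_ne hs, Matrix.of_apply]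
    rw [Finset.sum_congr rfl fun s _ => hF s,
      ← Finset.sum_range fun s => ent X (i + r.val) (1 + s) * ent u (1 + s) (1 + c.val)]
    rw [Finset.sum_Ico_eq_sum_range]
    symm
    refine Finset.sum_subset (Finset.range_subset_range.2 (by omega)) fun l _ hl => ?_
    rw [Finset.mem_range] at hl
    rw [hu.ent_eq_zero (by omega), mul_zero]

theorem Mmin_mul_unitriangular {R : Type*} [CommRing R] {n i : ℕ}
    {u : Matrix (Fin n) (Fin n) R} (hu : IsUT u) (hi1 : 1 ≤ i) (hi : i ≤ n) (j : ℕ)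
    (X : Matrix (Fin n) (Fin n) R) :
    Mmin i j (X * u) = ∑ l ∈ Finset.Ico 1 (n + 1), Mmin i l X * ent u l j := by
  rw [Mmin_eq_det_updateCol hi, det_updateCol_mul_unitriangular hu hi1 hi]
  have hcol : (fun r : Fin (n + 1 - i) => ent (X * u) (i + r.val) j) =
      ∑ l ∈ Finset.Ico 1 (n + 1), ent u l j • fun r : Fin (n + 1 - i) => ent X (i + r.val) l := by
    ext r
    simp [ent_mul, Finset.sum_apply, mul_comm]
  rw [hcol, ← Matrix.cramer_apply, map_sum, Finset.sum_apply]
  refine Finset.sum_congr rfl fun l _ => ?_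
  rw [map_smul, Pi.smul_apply, Matrix.cramer_apply, ← Mmin_eq_det_updateCol hi, smul_eq_mul,
    mul_comm]

theorem Mmin_eq_zero {R : Type*} [CommRing R] {n i j : ℕ} (hj1 : 1 ≤ j) (hj : j < n + 1 - i)
    (X : Matrix (Fin n) (Fin n) R) : Mmin i j X = 0 := by
  unfold Mmin
  refine Matrix.det_zero_of_column_eq (i := ⟨j - 1, by omega⟩) (j := ⟨n - i, by omega⟩)
    (by rw [Ne, Fin.ext_iff]; simp only; omega) fun r => ?_
  simp only [Matrix.of_apply, lt_irrefl, if_false]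
  rw [if_pos (by omega), Nat.add_sub_cancel' hj1]

/-- Reflection of a matrix in its antidiagonal. -/
def antitranspose {R : Type*} {n : ℕ} (X : Matrix (Fin n) (Fin n) R) :
    Matrix (Fin n) (Fin n) R :=
  Xᵀ.submatrix Fin.rev Fin.rev

theorem ent_antitranspose {R : Type*} [Zero R] {n : ℕ} (X : Matrix (Fin n) (Fin n) R) {p q : ℕ}
    (hp : p ≤ n + 1) (hq : q ≤ n + 1) :
    ent (antitranspose X) p q = ent X (n + 1 - q) (n + 1 - p) := by
  unfold ent
  by_cases h : 1 ≤ p ∧ p ≤ n ∧ 1 ≤ q ∧ q ≤ n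
  · rw [dif_pos h, dif_pos (by omega)]
    simp only [antitranspose, Matrix.submatrix_apply, Matrix.transpose_apply]
    congr 1 <;> (rw [Fin.ext_iff, Fin.val_rev]; simp only; omega)
  · rw [dif_neg h, dif_neg (by omega)]

theorem antitranspose_mul {R : Type*} [CommRing R] {n : ℕ} (X Y : Matrix (Fin n) (Fin n) R) :
    antitranspose (X * Y) = antitranspose Y * antitranspose X := by
  rw [antitranspose, Matrix.transpose_mul]
  exact (Matrix.submatrix_mul_equiv _ _ Fin.rev Fin.revPerm Fin.rev).symm

theorem IsUT.antitranspose {R : Type*} [CommRing R] {n : ℕ} {u : Matrix (Fin n) (Fin n) R}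
    (hu : IsUT u) : IsUT (antitranspose u) :=
  ⟨fun i => hu.1 i.rev, fun i j h => hu.2 j.rev i.rev (Fin.rev_lt_rev.2 h)⟩

theorem Nmin_eq_Mmin_antitranspose {R : Type*} [CommRing R] {n j k : ℕ} (hk1 : 1 ≤ k)
    (hj : j ≤ n + 1) (Y : Matrix (Fin n) (Fin n) R) :
    Nmin j k Y = Mmin k (n + 1 - j) (antitranspose Y) := by
  unfold Nmin Mmin
  rw [← Matrix.det_transpose, ← Matrix.det_submatrix_equiv_self Fin.revPerm]
  congr 1
  ext r c
  simp only [Matrix.submatrix_apply, Matrix.transpose_apply, Matrix.of_apply, Fin.revPerm_apply,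
    Fin.val_rev]
  rw [ent_antitranspose _ (by omega) (by split_ifs <;> omega)]
  congr 1 <;> grind

theorem Nmin_mul_unitriangular {R : Type*} [CommRing R] {n j k : ℕ}
    {u : Matrix (Fin n) (Fin n) R} (hu : IsUT u) (hk1 : 1 ≤ k) (hj : j ≤ n + 1)
    (Y : Matrix (Fin n) (Fin n) R) : Nmin j k (Y * u) = Nmin j k Y := by
  rw [Nmin_eq_Mmin_antitranspose hk1 hj, Nmin_eq_Mmin_antitranspose hk1 hj, antitranspose_mul,
    Mmin_unitriangular_mul hu.antitranspose hk1]

theorem Nmin_unitriangular_mul {R : Type*} [CommRing R] {n j k : ℕ}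
    {u : Matrix (Fin n) (Fin n) R} (hu : IsUT u) (hk1 : 1 ≤ k) (hk : k ≤ n) (hj : j ≤ n + 1)
    (Y : Matrix (Fin n) (Fin n) R) :
    Nmin j k (u * Y) = ∑ l ∈ Finset.Ico 1 (n + 1), ent u j l * Nmin l k Y := by
  rw [Nmin_eq_Mmin_antitranspose hk1 hj, antitranspose_mul,
    Mmin_mul_unitriangular hu.antitranspose hk1 hk]
  refine Finset.sum_nbij' (fun l => n + 1 - l) (fun l => n + 1 - l) ?_ ?_ ?_ ?_ ?_ <;>
    simp only [Finset.mem_Ico] <;> intro l hl <;> try omega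
  rw [Nmin_eq_Mmin_antitranspose hk1 (by omega), ent_antitranspose _ (by omega) (by omega),
    mul_comm, Nat.sub_sub_self hj, Nat.sub_sub_self (by omega)]

theorem Nmin_eq_zero {R : Type*} [CommRing R] {n j k : ℕ} (hk1 : 1 ≤ k) (hkj : k < j)
    (hj : j ≤ n) (Y : Matrix (Fin n) (Fin n) R) : Nmin j k Y = 0 := by
  rw [Nmin_eq_Mmin_antitranspose hk1 (by omega), Mmin_eq_zero (by omega) (by omega)]

theorem Pmin_eq_sum {R : Type*} [CommRing R] {n i k : ℕ} (hi : i ≤ n) (hk1 : 1 ≤ k) (hk : k ≤ n)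
    (X Y : Matrix (Fin n) (Fin n) R) :
    Pmin i k X Y = ∑ j ∈ Finset.Ico 1 (n + 1), Mmin i j X * Nmin j k Y := by
  refine Finset.sum_subset (fun j hj => ?_) fun j hj hj' => ?_
  · rw [Finset.mem_Icc] at hj
    rw [Finset.mem_Ico]
    omega
  · rw [Finset.mem_Ico] at hj
    rw [Finset.mem_Icc] at hj'
    by_cases h : j < n + 1 - i
    · rw [Mmin_eq_zero hj.1 h, zero_mul]
    · rw [Nmin_eq_zero hk1 (by omega) (by omega), mul_zero]

theorem Pmin_mul_left {R : Type*} [CommRing R] {n i k : ℕ} {u : Matrix (Fin n) (Fin n) R}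
    (hu : IsUT u) (hi1 : 1 ≤ i) (X Y : Matrix (Fin n) (Fin n) R) :
    Pmin i k (u * X) Y = Pmin i k X Y := by
  unfold Pmin
  simp only [Mmin_unitriangular_mul hu hi1]

theorem Pmin_mul_right {R : Type*} [CommRing R] {n i k : ℕ} {u : Matrix (Fin n) (Fin n) R}
    (hu : IsUT u) (hk1 : 1 ≤ k) (hk : k ≤ n) (X Y : Matrix (Fin n) (Fin n) R) :
    Pmin i k X (Y * u) = Pmin i k X Y := by
  refine Finset.sum_congr rfl fun j hj => ?_
  rw [Nmin_mul_unitriangular hu hk1 (by rw [Finset.mem_Icc] at hj; omega)]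

theorem Pmin_mul_middle {R : Type*} [CommRing R] {n i k : ℕ} {u : Matrix (Fin n) (Fin n) R}
    (hu : IsUT u) (hi1 : 1 ≤ i) (hi : i ≤ n) (hk1 : 1 ≤ k) (hk : k ≤ n)
    (X Y : Matrix (Fin n) (Fin n) R) : Pmin i k X (u * Y) = Pmin i k (X * u) Y := by
  rw [Pmin_eq_sum hi hk1 hk, Pmin_eq_sum hi hk1 hk]
  simp only [Mmin_mul_unitriangular hu hi1 hi, Finset.sum_mul]
  rw [Finset.sum_comm]
  refine Finset.sum_congr rfl fun j hj => ?_
  rw [Nmin_unitriangular_mul hu hk1 hk (by rw [Finset.mem_Ico] at hj; omega), Finset.mul_sum]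
  simp only [mul_assoc]

/-- the polynomials `P_{ik}` are `U`-invariants:
`P_{ik}(g₁ X g₂⁻¹, g₂ Y g₃⁻¹) = P_{ik}(X, Y)` for unitriangular `g₁, g₂, g₃`
and every pair `(i,k)` with `i' = n - i + 1 < k`. -/
theorem Pmin_unitriangular_invariant {K : Type*} [Field K] {n : ℕ} (hn : 1 ≤ n)
    (X Y g₁ g₂ g₃ : Matrix (Fin n) (Fin n) K)
    (h₁ : IsUT g₁) (h₂ : IsUT g₂) (h₃ : IsUT g₃)
    (i k : ℕ) (hi1 : 1 ≤ i) (hi2 : i ≤ n) (hk : k ≤ n) (hik : n + 1 - i < k) :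
    Pmin i k (g₁ * X * g₂⁻¹) (g₂ * Y * g₃⁻¹) = Pmin i k X Y := by
  have hk1 : 1 ≤ k := by omega
  have hg₂ : IsUnit g₂.det := by rw [h₂.det_eq_one]; exact isUnit_one
  have hg₃ : IsUnit g₃.det := by rw [h₃.det_eq_one]; exact isUnit_one
  rw [← Pmin_mul_right h₃ hk1 hk, Matrix.nonsing_inv_mul_cancel_right _ _ hg₃,
    Pmin_mul_middle h₂ hi1 hi2 hk1 hk, Matrix.nonsing_inv_mul_cancel_right _ _ hg₂,
    Pmin_mul_left h₁ hi1]
end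

section
/- Assume K is infinite. Then the restriction map π from the field of U_Q-invariant rational functions K(H)^{U_Q} to the field of rational functions K(S) on the section, which is injective, is in fact an isomorphism of fields; consequently K(H)^{U_Q} is a purely transcendental extension of K of transcendence degree equal to dim S = Σ_{α∈A} dim S_α. -/
open Matrix

open MvPolynomial in
/-- The substitution action `ρ_g` of `g = (g_v) ∈ Π_v GL(n)` on polynomial functions on
`H = Π_{α∈A} Mat(n,K)`: the coordinate function `x_{α,a,b}` is sent to the `(a,b)` entry of
`g_{t(α)}⁻¹ X_α g_{s(α)}`, so that `(ρ_g f)(h) = f(g⁻¹.h)`. -/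
noncomputable def polyAct (K : Type*) [Field K] (n : ℕ) {V A : Type*}
    (s t : A → V) (g : V → Matrix (Fin n) (Fin n) K) :
    MvPolynomial (A × Fin n × Fin n) K →ₐ[K] MvPolynomial (A × Fin n × Fin n) K :=
  aeval fun p : A × Fin n × Fin n =>
    ∑ c : Fin n, ∑ d : Fin n,
      C ((g (t p.1))⁻¹ p.2.1 c * g (s p.1) d p.2.2) * X (p.1, c, d)

/-- `f` is a `U_Q`-invariant rational function on `H = Π_{α∈A} Mat(n,K)`, where the field
`K(H)` of rational functions is realized as a fraction field `L` of the polynomial ring: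
for every unitriangular `g`, writing `f = p/q`, one has `ρ_g(p)/ρ_g(q) = p/q`. -/
def IsUInvariant (K : Type*) [Field K] (n : ℕ) {V A : Type*} (s t : A → V)
    (L : Type*) [Field L] [Algebra (MvPolynomial (A × Fin n × Fin n) K) L]
    (f : L) : Prop :=
  ∀ g : V → Matrix (Fin n) (Fin n) K, (∀ v, IsUT (g v)) →
    ∃ p q : MvPolynomial (A × Fin n × Fin n) K, q ≠ 0 ∧
      f * algebraMap (MvPolynomial (A × Fin n × Fin n) K) L q
        = algebraMap (MvPolynomial (A × Fin n × Fin n) K) L p ∧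
      polyAct K n s t g p * q = p * polyAct K n s t g q

/-- The coordinate `(a,b)` of the `α`-component is a free coordinate of the section
`S = Π_α S_α` (i.e. it is not forced to vanish on `S_α`). -/
def coordOK (n : ℕ) {V A : Type*} (s t : A → V) (ψ : V → A)
    (x : A × Fin n × Fin n) : Prop :=
  (s x.1 = t x.1 →
    (x.1 = ψ (s x.1) → n - 1 ≤ (x.2.1 : ℕ) + (x.2.2 : ℕ))) ∧
  (s x.1 ≠ t x.1 →
    ((x.1 = ψ (t x.1) ∧ x.1 ≠ ψ (s x.1)) → n - 1 ≤ (x.2.1 : ℕ) + (x.2.2 : ℕ)) ∧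
    ((x.1 = ψ (s x.1) ∧ x.1 ≠ ψ (t x.1)) → (x.2.1 : ℕ) + (x.2.2 : ℕ) ≤ n - 1) ∧
    ((x.1 = ψ (s x.1) ∧ x.1 = ψ (t x.1)) → (x.2.1 : ℕ) + (x.2.2 : ℕ) = n - 1))

open MvPolynomial Classical in
/-- Restriction of polynomial functions on `H` to the section `S`: coordinates that vanish
identically on `S` are sent to `0`, free coordinates to the corresponding coordinate on `S`. -/
noncomputable def resPoly (K : Type*) [Field K] (n : ℕ) {V A : Type*}
    (s t : A → V) (ψ : V → A) :
    MvPolynomial (A × Fin n × Fin n) K →ₐ[K]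
      MvPolynomial {x : A × Fin n × Fin n // coordOK n s t ψ x} K :=
  aeval fun x : A × Fin n × Fin n =>
    if h : coordOK n s t ψ x then X ⟨x, h⟩ else 0

/-- `r ∈ K(S)` is the restriction `π(f)` of the rational function `f ∈ K(H)`:
for some representation `f = p/q` with `q|_S ≠ 0`, one has `r = (p|_S)/(q|_S)`. -/
def resRel (K : Type*) [Field K] (n : ℕ) {V A : Type*} (s t : A → V) (ψ : V → A)
    (L : Type*) [Field L] [Algebra (MvPolynomial (A × Fin n × Fin n) K) L]
    (LS : Type*) [Field LS]
    [Algebra (MvPolynomial {x : A × Fin n × Fin n // coordOK n s t ψ x} K) LS]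
    (f : L) (r : LS) : Prop :=
  ∃ p q : MvPolynomial (A × Fin n × Fin n) K, q ≠ 0 ∧
    f * algebraMap (MvPolynomial (A × Fin n × Fin n) K) L q
      = algebraMap (MvPolynomial (A × Fin n × Fin n) K) L p ∧
    resPoly K n s t ψ q ≠ 0 ∧
    r * algebraMap (MvPolynomial {x : A × Fin n × Fin n // coordOK n s t ψ x} K) LS
          (resPoly K n s t ψ q)
      = algebraMap (MvPolynomial {x : A × Fin n × Fin n // coordOK n s t ψ x} K) LS
          (resPoly K n s t ψ p)

namespace IsUT

variable {R : Type*} [CommRing R] {n : ℕ} {u w : Matrix (Fin n) (Fin n) R}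

theorem blockTriangular (hu : IsUT u) : u.BlockTriangular id := fun i j h => hu.2 i j h

theorem det_eq_one_s16 (hu : IsUT u) : u.det = 1 := by
  rw [Matrix.det_of_isUpperTriangular hu.blockTriangular]
  exact Finset.prod_eq_one fun i _ => hu.1 i

theorem isUnit_det (hu : IsUT u) : IsUnit u.det := by
  rw [hu.det_eq_one_s16]
  exact isUnit_one

theorem mul_inv (hu : IsUT u) : u * u⁻¹ = 1 := Matrix.mul_nonsing_inv _ hu.isUnit_det

theorem inv_mul (hu : IsUT u) : u⁻¹ * u = 1 := Matrix.nonsing_inv_mul _ hu.isUnit_det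

theorem inv_inv (hu : IsUT u) : u⁻¹⁻¹ = u := Matrix.nonsing_inv_nonsing_inv _ hu.isUnit_det

theorem one : IsUT (1 : Matrix (Fin n) (Fin n) R) :=
  ⟨fun i => Matrix.one_apply_eq i, fun i j h => Matrix.one_apply_ne (by
    rintro rfl
    exact lt_irrefl _ h)⟩

theorem diag_mul (hu : u.BlockTriangular id) (hw : w.BlockTriangular id) (i : Fin n) :
    (u * w) i i = u i i * w i i := by
  rw [Matrix.mul_apply, Finset.sum_eq_single i]
  · intro j _ hj
    rcases lt_or_gt_of_ne hj with h | h
    · rw [hu h, zero_mul]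
    · rw [hw h, mul_zero]
  · simp

theorem mul (hu : IsUT u) (hw : IsUT w) : IsUT (u * w) :=
  ⟨fun i => by rw [diag_mul hu.blockTriangular hw.blockTriangular, hu.1, hw.1, one_mul],
    fun _ _ h => hu.blockTriangular.mul hw.blockTriangular h⟩

theorem inv (hu : IsUT u) : IsUT u⁻¹ := by
  have : Invertible u := Matrix.invertibleOfIsUnitDet u hu.isUnit_det
  have hb : u⁻¹.BlockTriangular id :=
    Matrix.blockTriangular_inv_of_blockTriangular hu.blockTriangular
  refine ⟨fun i => ?_, fun _ _ h => hb h⟩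
  have := diag_mul hu.blockTriangular hb i
  rw [hu.mul_inv, Matrix.one_apply_eq, hu.1, one_mul] at this
  exact this.symm

theorem map {S : Type*} [CommRing S] (hu : IsUT u) (f : R →+* S) : IsUT (u.map f) :=
  ⟨fun i => by simp [hu.1], fun i j h => by simp [hu.2 i j h]⟩

theorem map_inv {S : Type*} [CommRing S] (hu : IsUT u) (f : R →+* S) :
    (u.map f)⁻¹ = u⁻¹.map f := by
  apply Matrix.inv_eq_left_inv
  rw [← Matrix.map_mul, hu.inv_mul, Matrix.map_one _ f.map_zero f.map_one]

theorem eq_one_of_lower (hu : IsUT u) (hl : u.BlockTriangular OrderDual.toDual) : u = 1 := by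
  ext i j
  rcases lt_trichotomy i j with h | rfl | h
  · rw [Matrix.one_apply_ne h.ne]
    exact hl h
  · rw [hu.1, Matrix.one_apply_eq]
  · rw [Matrix.one_apply_ne h.ne']
    exact hu.2 i j h

end IsUT

section Antitriangular

variable {R : Type*} [CommRing R] {n : ℕ}

theorem LowerAnti.mul_isUT {y u : Matrix (Fin n) (Fin n) R} (hy : LowerAnti y) (hu : IsUT u) :
    LowerAnti (y * u) := by
  intro a b hab
  rw [Matrix.mul_apply]
  refine Finset.sum_eq_zero fun c _ => ?_
  by_cases h : (b : ℕ) < c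
  · rw [hu.2 c b h, mul_zero]
  · rw [hy a c (by omega), zero_mul]

theorem UpperAnti.isUT_mul {y u : Matrix (Fin n) (Fin n) R} (hy : UpperAnti y) (hu : IsUT u) :
    UpperAnti (u * y) := by
  intro a b hab
  rw [Matrix.mul_apply]
  refine Finset.sum_eq_zero fun c _ => ?_
  by_cases h : (c : ℕ) < a
  · rw [hu.2 a c h, zero_mul]
  · rw [hy c b (by omega), mul_zero]

theorem LowerAnti.lower_submatrix {y : Matrix (Fin n) (Fin n) R} (hy : LowerAnti y) :
    (y.submatrix id Fin.revPerm).BlockTriangular OrderDual.toDual := by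
  intro i j h
  have h' : (i : ℕ) < j := h
  refine hy _ _ ?_
  simp only [id, Fin.revPerm_apply, Fin.val_rev]
  omega

theorem UpperAnti.lower_submatrix {y : Matrix (Fin n) (Fin n) R} (hy : UpperAnti y) :
    (y.submatrix Fin.revPerm id).BlockTriangular OrderDual.toDual := by
  intro i j h
  have h' : (i : ℕ) < j := h
  refine hy _ _ ?_
  simp only [id, Fin.revPerm_apply, Fin.val_rev]
  omega

theorem LowerAnti.eq_one_of_isUT_mul {e y z : Matrix (Fin n) (Fin n) R} (he : IsUT e)
    (hy : LowerAnti y) (hz : LowerAnti z) (hu : IsUnit y) (h : e * y = z) : e = 1 := by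
  apply he.eq_one_of_lower
  have hu' : IsUnit (y.submatrix id Fin.revPerm) :=
    (Matrix.isUnit_submatrix_equiv (A := y) (Equiv.refl _) Fin.revPerm).2 hu
  have := hu'.invertible
  have hmul : e * y.submatrix id Fin.revPerm = z.submatrix id Fin.revPerm := by
    rw [← h]
    rfl
  have := (hz.lower_submatrix).mul
    (Matrix.blockTriangular_inv_of_blockTriangular hy.lower_submatrix)
  rwa [← hmul, Matrix.mul_assoc, Matrix.mul_inv_of_invertible, Matrix.mul_one] at this

theorem UpperAnti.eq_one_of_mul_isUT {e y z : Matrix (Fin n) (Fin n) R} (he : IsUT e)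
    (hy : UpperAnti y) (hz : UpperAnti z) (hu : IsUnit y) (h : y * e = z) : e = 1 := by
  apply he.eq_one_of_lower
  have hu' : IsUnit (y.submatrix Fin.revPerm id) :=
    (Matrix.isUnit_submatrix_equiv (A := y) Fin.revPerm (Equiv.refl _)).2 hu
  have := hu'.invertible
  have hmul : y.submatrix Fin.revPerm id * e = z.submatrix Fin.revPerm id := by
    rw [← h]
    rfl
  have := (Matrix.blockTriangular_inv_of_blockTriangular hy.lower_submatrix).mul
    (hz.lower_submatrix)
  rwa [← hmul, ← Matrix.mul_assoc, Matrix.inv_mul_of_invertible, Matrix.one_mul] at this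

/-- Elimination above the diagonal over a ring `O` with a map `π` to a domain that detects units:
a matrix whose image is lower triangular with nonzero diagonal becomes lower triangular after left
multiplication by a unitriangular matrix that is trivial modulo `π`. -/
theorem exists_unitriangular_mul_lower {ι O k : Type*} [LinearOrder ι] [Fintype ι] [CommRing O]
    [CommRing k] [IsDomain k] (π : O →+* k) (hπ : ∀ x, π x ≠ 0 → IsUnit x) (M : Matrix ι ι O)
    (hlow : ∀ i j, i < j → π (M i j) = 0) (hdiag : ∀ i, π (M i i) ≠ 0) :
    ∃ γ : Matrix ι ι O, (∀ i, γ i i = 1) ∧ (∀ i j, j < i → γ i j = 0) ∧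
      (∀ i j, i < j → (γ * M) i j = 0) ∧ γ.map π = 1 := by
  classical
  let D : ∀ i : ι, Matrix {j // i < j} {j // i < j} O := fun i => M.submatrix (↑) (↑)
  let row : ∀ i : ι, {j // i < j} → O := fun i j => M i j
  have hD : ∀ i, IsUnit (D i).det := by
    intro i
    apply hπ
    rw [RingHom.map_det, Matrix.det_of_isLowerTriangular]
    · exact Finset.prod_ne_zero_iff.2 fun j _ => hdiag j
    · intro a b h
      exact hlow a b h
  let γ : Matrix ι ι O := Matrix.of fun i j =>
    if h : i < j then -(Matrix.vecMul (row i) (D i)⁻¹) ⟨j, h⟩ else if i = j then 1 else 0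
  have h1 : ∀ i, γ i i = 1 := fun i => by simp [γ]
  have h2 : ∀ i j, j < i → γ i j = 0 := fun i j h => by simp [γ, h.not_gt, h.ne']
  refine ⟨γ, h1, h2, ?_, ?_⟩
  · intro i b hib
    have hsolve : ∑ j : {j // i < j}, Matrix.vecMul (row i) (D i)⁻¹ j * M j b = M i b := by
      have : Matrix.vecMul (Matrix.vecMul (row i) (D i)⁻¹) (D i) = row i := by
        rw [Matrix.vecMul_vecMul, Matrix.nonsing_inv_mul _ (hD i), Matrix.vecMul_one]
      exact congrFun this ⟨b, hib⟩
    rw [Matrix.mul_apply, ← Finset.sum_filter_add_sum_filter_not _ (fun j => i < j)]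
    have hs1 : ∑ j with i < j, γ i j * M j b = - M i b := by
      rw [← hsolve, ← Finset.sum_neg_distrib,
        ← Finset.sum_subtype_of_mem (p := fun j => i < j) (fun j => γ i j * M j b) (by simp),
        Finset.subtype_eq_univ.2 (by simp)]
      refine Finset.sum_congr rfl fun j _ => ?_
      simp [γ, j.2]
    have hs2 : ∑ j with ¬ i < j, γ i j * M j b = M i b := by
      rw [Finset.sum_eq_single i]
      · rw [h1, one_mul]
      · intro j hj hji
        rw [h2 i j (lt_of_le_of_ne (not_lt.1 (Finset.mem_filter.1 hj).2) hji), zero_mul]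
      · simp
    rw [hs1, hs2, neg_add_cancel]
  · ext i j
    rcases lt_trichotomy i j with h | rfl | h
    · rw [Matrix.one_apply_ne h.ne]
      simp only [γ, Matrix.map_apply, Matrix.of_apply, dif_pos h, Matrix.vecMul, dotProduct,
        map_neg, map_sum, map_mul, neg_eq_zero]
      exact Finset.sum_eq_zero fun l _ => by rw [hlow i l l.2, zero_mul]
    · simp [h1]
    · simp [h2 i j h, Matrix.one_apply_ne h.ne']

theorem exists_isUT_mul_lowerAnti {O k : Type*} [CommRing O] [CommRing k] [IsDomain k]
    (π : O →+* k) (hπ : ∀ x, π x ≠ 0 → IsUnit x) (M : Matrix (Fin n) (Fin n) O)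
    (hlow : LowerAnti (M.map π)) (hdiag : ∀ i, π (M i i.rev) ≠ 0) :
    ∃ γ : Matrix (Fin n) (Fin n) O, IsUT γ ∧ LowerAnti (γ * M) ∧ γ.map π = 1 := by
  obtain ⟨γ, h1, h2, h3, h4⟩ := exists_unitriangular_mul_lower π hπ
    (M.submatrix id Fin.revPerm) (fun i j h => hlow.lower_submatrix h) hdiag
  refine ⟨γ, ⟨h1, fun i j h => h2 i j h⟩, fun a b hab => ?_, h4⟩
  have := h3 a b.rev (by
    rw [Fin.lt_def, Fin.val_rev]
    omega)
  simpa [Matrix.mul_apply] using this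

theorem exists_isUT_mul_upperAnti {O k : Type*} [CommRing O] [CommRing k] [IsDomain k]
    (π : O →+* k) (hπ : ∀ x, π x ≠ 0 → IsUnit x) (M : Matrix (Fin n) (Fin n) O)
    (hup : UpperAnti (M.map π)) (hdiag : ∀ i, π (M i i.rev) ≠ 0) :
    ∃ δ : Matrix (Fin n) (Fin n) O, IsUT δ ∧ UpperAnti (M * δ) ∧ δ.map π = 1 := by
  obtain ⟨γ, h1, h2, h3, h4⟩ := exists_unitriangular_mul_lower (ι := (Fin n)ᵒᵈ) π hπ
    (Matrix.of fun i j => M (Fin.rev (OrderDual.ofDual j)) (OrderDual.ofDual i))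
    (fun i j h => hup.lower_submatrix (i := OrderDual.ofDual j) (j := OrderDual.ofDual i) h)
    (fun i => by simpa using hdiag (Fin.rev (OrderDual.ofDual i)))
  refine ⟨Matrix.of fun i j => γ (OrderDual.toDual j) (OrderDual.toDual i),
    ⟨fun i => h1 _, fun i j h => h2 _ _ h⟩, fun a b hab => ?_, ?_⟩
  · have hlt : OrderDual.toDual b < OrderDual.toDual a.rev := by
      rw [OrderDual.toDual_lt_toDual, Fin.lt_def, Fin.val_rev]
      omega
    have := h3 _ _ hlt
    rw [Matrix.mul_apply] at this ⊢
    rw [← this, ← OrderDual.toDual.sum_comp]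
    exact Finset.sum_congr rfl fun c _ => by simp [mul_comm]
  · ext i j
    have := congrFun (congrFun h4 (OrderDual.toDual j)) (OrderDual.toDual i)
    simpa [Matrix.one_apply, eq_comm] using this

end Antitriangular

section QuiverAction

variable {K : Type*} [Field K] {n : ℕ} {V A : Type*} (s t : A → V)

/-- The point `(g_{t(α)}⁻¹ y_α g_{s(α)})_α`, i.e. `g⁻¹.y`, with coordinates in a ring `B`. -/
noncomputable def actInv {B : Type*} [CommRing B] (g : V → Matrix (Fin n) (Fin n) B)
    (y : A → Matrix (Fin n) (Fin n) B) : A → Matrix (Fin n) (Fin n) B :=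
  fun α => (g (t α))⁻¹ * y α * g (s α)

theorem actInv_actInv_inv {B : Type*} [CommRing B] {g : V → Matrix (Fin n) (Fin n) B}
    (hg : ∀ v, IsUT (g v)) (y : A → Matrix (Fin n) (Fin n) B) :
    actInv s t (fun v => (g v)⁻¹) (actInv s t g y) = y := by
  funext α
  simp only [actInv, (hg _).inv_inv]
  rw [← Matrix.mul_assoc, ← Matrix.mul_assoc, (hg _).mul_inv, Matrix.one_mul, Matrix.mul_assoc,
    (hg _).mul_inv, Matrix.mul_one]

theorem actInv_inv_actInv {B : Type*} [CommRing B] {g : V → Matrix (Fin n) (Fin n) B}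
    (hg : ∀ v, IsUT (g v)) (y : A → Matrix (Fin n) (Fin n) B) :
    actInv s t g (actInv s t (fun v => (g v)⁻¹) y) = y := by
  have := actInv_actInv_inv s t (fun v => (hg v).inv) y
  simpa only [(hg _).inv_inv] using this

/-- Evaluation of polynomial functions on `H` at a point with coordinates in `B`. -/
noncomputable def evalAt {B : Type*} [CommRing B] [Algebra K B]
    (y : A → Matrix (Fin n) (Fin n) B) : MvPolynomial (A × Fin n × Fin n) K →ₐ[K] B :=
  MvPolynomial.aeval fun x => y x.1 x.2.1 x.2.2

@[simp]
theorem evalAt_X {B : Type*} [CommRing B] [Algebra K B] (y : A → Matrix (Fin n) (Fin n) B)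
    (x : A × Fin n × Fin n) : evalAt (K := K) y (MvPolynomial.X x) = y x.1 x.2.1 x.2.2 :=
  MvPolynomial.aeval_X _ _

variable (K n A) in
/-- The generic point of `H`. -/
noncomputable def quiverPoint :
    A → Matrix (Fin n) (Fin n) (MvPolynomial (A × Fin n × Fin n) K) :=
  fun α => Matrix.of fun a b => MvPolynomial.X (α, a, b)

theorem map_actInv {B B' : Type*} [CommRing B] [CommRing B'] (φ : B →+* B')
    {g : V → Matrix (Fin n) (Fin n) B} (hg : ∀ v, IsUT (g v))
    (y : A → Matrix (Fin n) (Fin n) B) (α : A) :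
    (actInv s t g y α).map φ =
      actInv s t (fun v => (g v).map φ) (fun α => (y α).map φ) α := by
  simp only [actInv, Matrix.map_mul, (hg _).map_inv]

theorem map_evalAt {B B' : Type*} [CommRing B] [CommRing B'] [Algebra K B] [Algebra K B']
    (φ : B →ₐ[K] B') (y : A → Matrix (Fin n) (Fin n) B)
    (p : MvPolynomial (A × Fin n × Fin n) K) :
    φ (evalAt y p) = evalAt (fun α => (y α).map φ) p := by
  have : φ.comp (evalAt y) = evalAt fun α => (y α).map φ := by
    ext x
    simp
  exact DFunLike.congr_fun this p

theorem map_evalAt_actInv {B B' : Type*} [CommRing B] [CommRing B'] [Algebra K B] [Algebra K B']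
    (φ : B →ₐ[K] B') {g : V → Matrix (Fin n) (Fin n) B} (hg : ∀ v, IsUT (g v))
    (y : A → Matrix (Fin n) (Fin n) B) (p : MvPolynomial (A × Fin n × Fin n) K) :
    φ (evalAt (actInv s t g y) p) =
      evalAt (actInv s t (fun v => (g v).map φ) fun α => (y α).map φ) p := by
  rw [map_evalAt]
  congr 2
  funext α
  exact map_actInv s t (φ : B →+* B') hg _ α

theorem evalAt_generic {B : Type*} [CommRing B] [Algebra K B]
    [Algebra (MvPolynomial (A × Fin n × Fin n) K) B]
    [IsScalarTower K (MvPolynomial (A × Fin n × Fin n) K) B]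
    (p : MvPolynomial (A × Fin n × Fin n) K) :
    evalAt (fun α => (quiverPoint K n A α).map (algebraMap _ B)) p = algebraMap _ B p := by
  have : evalAt (fun α => (quiverPoint K n A α).map (algebraMap _ B)) =
      IsScalarTower.toAlgHom K (MvPolynomial (A × Fin n × Fin n) K) B := by
    ext x
    simp [quiverPoint]
  rw [this]
  rfl

theorem evalAt_quiverPoint (p : MvPolynomial (A × Fin n × Fin n) K) :
    evalAt (quiverPoint K n A) p = p := by
  have : evalAt (quiverPoint K n A) = AlgHom.id K _ := by
    ext x
    simp [quiverPoint]
  rw [this]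
  rfl

theorem polyAct_eq_evalAt (g : V → Matrix (Fin n) (Fin n) K)
    (p : MvPolynomial (A × Fin n × Fin n) K) :
    polyAct K n s t g p =
      evalAt (fun α => ((g (t α))⁻¹).map MvPolynomial.C * quiverPoint K n A α *
        (g (s α)).map MvPolynomial.C) p := by
  rw [polyAct, evalAt]
  congr 2
  funext x
  simp only [Matrix.mul_apply, Finset.sum_mul]
  rw [Finset.sum_comm]
  refine Finset.sum_congr rfl fun d _ => Finset.sum_congr rfl fun c _ => ?_
  simp only [quiverPoint, Matrix.map_apply, Matrix.of_apply, map_mul]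
  ring

/-- Applying a `K`-algebra homomorphism after the substitution action of `g`. -/
theorem evalAt_polyAct {B : Type*} [CommRing B] [Algebra K B]
    {g : V → Matrix (Fin n) (Fin n) K} (hg : ∀ v, IsUT (g v))
    (y : A → Matrix (Fin n) (Fin n) B) (p : MvPolynomial (A × Fin n × Fin n) K) :
    evalAt y (polyAct K n s t g p) =
      evalAt (actInv s t (fun v => (g v).map (algebraMap K B)) y) p := by
  rw [polyAct_eq_evalAt, map_evalAt]
  congr 2
  funext α
  have hC : ∀ M : Matrix (Fin n) (Fin n) K,
      (M.map MvPolynomial.C).map (evalAt (K := K) y) = M.map (algebraMap K B) := by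
    intro M
    ext i j
    simp [evalAt]
  have hX : (quiverPoint K n A α).map (evalAt (K := K) y) = y α := by
    ext i j
    simp [evalAt, quiverPoint]
  rw [Matrix.map_mul, Matrix.map_mul, hC, hC, hX, actInv, (hg _).map_inv]

theorem polyAct_eq_evalAt_actInv {g : V → Matrix (Fin n) (Fin n) K} (hg : ∀ v, IsUT (g v))
    (p : MvPolynomial (A × Fin n × Fin n) K) :
    polyAct K n s t g p =
      evalAt (actInv s t (fun v => (g v).map (algebraMap K _)) (quiverPoint K n A)) p := by
  rw [← evalAt_polyAct s t hg, evalAt_quiverPoint]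

theorem polyAct_injective {g : V → Matrix (Fin n) (Fin n) K} (hg : ∀ v, IsUT (g v)) :
    Function.Injective (polyAct K n (A := A) s t g) := by
  have key : ∀ p, polyAct K n s t (fun v => (g v)⁻¹) (polyAct K n s t g p) = p := by
    intro p
    rw [polyAct_eq_evalAt_actInv s t (fun v => (hg v).inv), evalAt_polyAct s t hg]
    simp only [← (hg _).map_inv]
    rw [actInv_inv_actInv s t (fun v => (hg v).map _), evalAt_quiverPoint]
  exact Function.LeftInverse.injective key

variable (n V) in
/-- The generic unitriangular family over a ring `R`. -/
noncomputable def genericUT (R : Type*) [CommRing R] :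
    V → Matrix (Fin n) (Fin n) (MvPolynomial (V × Fin n × Fin n) R) :=
  fun v => Matrix.of fun a b =>
    if a = b then 1 else if a < b then MvPolynomial.X (v, a, b) else 0

theorem isUT_genericUT {R : Type*} [CommRing R] (v : V) : IsUT (genericUT n V R v) :=
  ⟨fun i => by simp [genericUT], fun i j h => by
    have h' : j < i := h
    simp [genericUT, h'.ne', h'.not_gt]⟩

theorem genericUT_map {R B : Type*} [CommRing R] [CommRing B]
    (θ : MvPolynomial (V × Fin n × Fin n) R →+* B) {g : V → Matrix (Fin n) (Fin n) B}
    (hg : ∀ v, IsUT (g v)) (hθ : ∀ v a b, a < b → θ (MvPolynomial.X (v, a, b)) = g v a b) (v : V) :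
    (genericUT n V R v).map θ = g v := by
  ext a b
  rcases lt_trichotomy a b with h | rfl | h
  · simp [genericUT, h.ne, h, hθ]
  · simp [genericUT, (hg v).1]
  · simp [genericUT, h.ne', h.not_gt, (hg v).2 a b h]

/-- Specialization of the action of the generic unitriangular family on the generic point. -/
theorem specialize_generic_action {B : Type*} [CommRing B] [Algebra K B]
    (θ : MvPolynomial (V × Fin n × Fin n) (MvPolynomial (A × Fin n × Fin n) K) →ₐ[K] B)
    {g : V → Matrix (Fin n) (Fin n) B} (hg : ∀ v, IsUT (g v))
    (y : A → Matrix (Fin n) (Fin n) B)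
    (hθ : ∀ v a b, a < b → θ (MvPolynomial.X (v, a, b)) = g v a b)
    (hy : ∀ r, θ (MvPolynomial.C r) = evalAt y r) (r : MvPolynomial (A × Fin n × Fin n) K) :
    θ (evalAt (actInv s t (genericUT n V _)
      fun α => (quiverPoint K n A α).map MvPolynomial.C) r) = evalAt (actInv s t g y) r := by
  rw [map_evalAt_actInv s t θ isUT_genericUT]
  have h1 : (fun v => (genericUT n V (MvPolynomial (A × Fin n × Fin n) K) v).map θ) = g :=
    funext fun v => genericUT_map θ.toRingHom hg hθ v
  have h2 : (fun α => ((quiverPoint K n A α).map MvPolynomial.C).map θ) = y := by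
    funext α
    ext a b
    simp [quiverPoint, hy]
  rw [h1, h2]

section FieldAction

variable {L : Type*} [Field L] [Algebra (MvPolynomial (A × Fin n × Fin n) K) L]
  [IsFractionRing (MvPolynomial (A × Fin n × Fin n) K) L]
  [Algebra K L] [IsScalarTower K (MvPolynomial (A × Fin n × Fin n) K) L]

variable (L) in
/-- The generic point of `H`, with coordinates in the field of rational functions. -/
noncomputable def ratPoint : A → Matrix (Fin n) (Fin n) L :=
  fun α => (quiverPoint K n A α).map (algebraMap _ L)

variable (K L) in
/-- The automorphism `ρ_g` of the field of rational functions. -/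
noncomputable def fieldAct {g : V → Matrix (Fin n) (Fin n) K} (hg : ∀ v, IsUT (g v)) :
    L →ₐ[K] L :=
  IsFractionRing.liftAlgHom
    (g := (IsScalarTower.toAlgHom K (MvPolynomial (A × Fin n × Fin n) K) L).comp
      (polyAct K n s t g))
    ((IsFractionRing.injective _ L).comp (polyAct_injective s t hg))

theorem fieldAct_algebraMap {g : V → Matrix (Fin n) (Fin n) K} (hg : ∀ v, IsUT (g v))
    (p : MvPolynomial (A × Fin n × Fin n) K) :
    fieldAct K s t L hg (algebraMap _ L p) = algebraMap _ L (polyAct K n s t g p) := by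
  exact IsLocalization.lift_eq _ _

theorem isUInvariant_iff_fieldAct (f : L) :
    IsUInvariant K n s t L f ↔
      ∀ (g : V → Matrix (Fin n) (Fin n) K) (hg : ∀ v, IsUT (g v)),
        fieldAct K s t L hg f = f := by
  have hinj := IsFractionRing.injective (MvPolynomial (A × Fin n × Fin n) K) L
  refine forall_congr' fun g => forall_congr' fun hg => ⟨?_, fun h => ?_⟩
  · rintro ⟨p, q, hq, hf, h⟩
    have hq' : algebraMap _ L q ≠ 0 := by simpa using hq
    have hgq : algebraMap _ L (polyAct K n s t g q) ≠ 0 := by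
      simpa using (map_ne_zero_iff _ (polyAct_injective s t hg)).2 hq
    have h1 := congrArg (fieldAct K s t L hg) hf
    rw [map_mul, fieldAct_algebraMap, fieldAct_algebraMap] at h1
    have h2 := congrArg (algebraMap _ L) h
    rw [map_mul, map_mul, ← h1, ← hf] at h2
    have h3 : (fieldAct K s t L hg f - f) *
        (algebraMap _ L (polyAct K n s t g q) * algebraMap _ L q) = 0 := by
      linear_combination h2
    exact sub_eq_zero.1 ((mul_eq_zero.1 h3).resolve_right (mul_ne_zero hgq hq'))
  · obtain ⟨p, q, hq, hpq⟩ := IsFractionRing.div_surjective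
      (A := MvPolynomial (A × Fin n × Fin n) K) f
    have hq0 : algebraMap _ L q ≠ 0 := by
      simpa using nonZeroDivisors.ne_zero hq
    have hf : f * algebraMap _ L q = algebraMap _ L p := by
      rw [← hpq, div_mul_cancel₀ _ hq0]
    refine ⟨p, q, nonZeroDivisors.ne_zero hq, hf, hinj ?_⟩
    have h1 := congrArg (fieldAct K s t L hg) hf
    rw [map_mul, fieldAct_algebraMap, fieldAct_algebraMap, h] at h1
    rw [map_mul, map_mul, ← h1, ← hf]
    ring

variable (K L) in
/-- The subfield of `U_Q`-invariant rational functions. -/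
noncomputable def invariantField : IntermediateField K L where
  carrier := {f | IsUInvariant K n s t L f}
  mul_mem' := by
    intro a b ha hb
    simp only [Set.mem_ofPred_eq, isUInvariant_iff_fieldAct] at ha hb ⊢
    intro g hg
    rw [map_mul, ha, hb]
  add_mem' := by
    intro a b ha hb
    simp only [Set.mem_ofPred_eq, isUInvariant_iff_fieldAct] at ha hb ⊢
    intro g hg
    rw [map_add, ha, hb]
  algebraMap_mem' := by
    intro a
    simp only [Set.mem_ofPred_eq, isUInvariant_iff_fieldAct]
    intro g hg
    rw [AlgHom.commutes]
  inv_mem' := by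
    intro a ha
    simp only [Set.mem_ofPred_eq, isUInvariant_iff_fieldAct] at ha ⊢
    intro g hg
    rw [map_inv₀, ha]

/-- Every invariant is a quotient of two polynomials that are multiplied by the same factor when a
point is moved along its orbit, over every coefficient algebra. -/
theorem IsUInvariant.exists_semiInvariant [Infinite K] {f : L} (hf : IsUInvariant K n s t L f) :
    ∃ p q : MvPolynomial (A × Fin n × Fin n) K, q ≠ 0 ∧
      f * algebraMap _ L q = algebraMap _ L p ∧
      ∀ (g : V → Matrix (Fin n) (Fin n) L) (_ : ∀ v, IsUT (g v))
        (y : A → Matrix (Fin n) (Fin n) L), ∃ c : L,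
          evalAt (actInv s t g y) p = c * evalAt y p ∧
          evalAt (actInv s t g y) q = c * evalAt y q := by
  classical
  let R := MvPolynomial (A × Fin n × Fin n) K
  let σ := V × Fin n × Fin n
  have hinj := IsFractionRing.injective R L
  let p : R := IsFractionRing.num R f
  let q : R := IsFractionRing.den R f
  have hq : q ≠ 0 := nonZeroDivisors.ne_zero (IsFractionRing.den R f).2
  have hq0 : algebraMap R L q ≠ 0 := by simpa using hq
  have hpq : f * algebraMap R L q = algebraMap R L p := by
    rw [← IsFractionRing.mk'_num_den' R f, div_mul_cancel₀ _ hq0]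
  have hrel : IsRelPrime p q := IsFractionRing.num_den_reduced R f
  have hconst : ∀ (g : V → Matrix (Fin n) (Fin n) K), (∀ v, IsUT (g v)) →
      polyAct K n s t g p * q = p * polyAct K n s t g q := by
    intro g hg
    apply hinj
    have h1 := congrArg (fieldAct K s t L hg) hpq
    rw [map_mul, fieldAct_algebraMap, fieldAct_algebraMap,
      (isUInvariant_iff_fieldAct s t f).1 hf] at h1
    rw [map_mul, map_mul, ← h1, ← hpq]
    ring
  obtain ⟨Φ, hΦ⟩ : ∃ Φ : R →ₐ[K] MvPolynomial σ R, Φ = evalAt (actInv s t (genericUT n V R)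
    fun α => (quiverPoint K n A α).map MvPolynomial.C) := ⟨_, rfl⟩
  have hgen : Φ p * MvPolynomial.C q = MvPolynomial.C p * Φ q := by
    refine MvPolynomial.funext_set (fun _ => Set.range (MvPolynomial.C : K → R))
      (fun _ => Set.infinite_range_of_injective (MvPolynomial.C_injective _ _)) fun x hx => ?_
    choose e he using fun i => hx i trivial
    let g : V → Matrix (Fin n) (Fin n) K := fun v => Matrix.of fun a b =>
      if a = b then 1 else if a < b then e (v, a, b) else 0
    have hg : ∀ v, IsUT (g v) := fun v =>
      ⟨fun i => by simp [g], fun i j h => by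
        have h' : j < i := h
        simp [g, h'.ne', h'.not_gt]⟩
    have hev : ∀ r, MvPolynomial.eval x (Φ r) = polyAct K n s t g r := by
      intro r
      rw [hΦ, polyAct_eq_evalAt_actInv s t hg]
      refine specialize_generic_action s t
        ((MvPolynomial.aeval x : MvPolynomial σ R →ₐ[R] R).restrictScalars K)
        (fun v => (hg v).map _) _ (fun v a b h => ?_) (fun r => ?_) r
      · simp [g, h.ne, h, ← he, MvPolynomial.algebraMap_eq]
      · rw [evalAt_quiverPoint]
        simp
    rw [map_mul, map_mul, hev, hev, MvPolynomial.eval_C, MvPolynomial.eval_C, hconst g hg]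
  obtain ⟨c, hc⟩ : MvPolynomial.C q ∣ Φ q := by
    rw [MvPolynomial.C_dvd_iff_dvd_coeff]
    intro i
    have h : MvPolynomial.C q ∣ MvPolynomial.C p * Φ q := ⟨Φ p, by rw [← hgen, mul_comm]⟩
    rw [MvPolynomial.C_dvd_iff_dvd_coeff] at h
    have := h i
    rw [MvPolynomial.coeff_C_mul] at this
    exact hrel.symm.dvd_of_dvd_mul_left this
  have hc' : Φ p = MvPolynomial.C p * c := by
    have hCq : (MvPolynomial.C q : MvPolynomial σ R) ≠ 0 := by simpa using hq
    refine mul_right_cancel₀ hCq ?_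
    rw [hgen, hc]
    ring
  refine ⟨p, q, hq, hpq, fun g hg y => ?_⟩
  let θ : MvPolynomial σ R →ₐ[K] L :=
    MvPolynomial.aevalTower (evalAt y) fun x => g x.1 x.2.1 x.2.2
  have hθ : ∀ r, θ (Φ r) = evalAt (actInv s t g y) r := by
    intro r
    rw [hΦ]
    exact specialize_generic_action s t θ hg y (fun v a b _ => by simp [θ]) (by simp [θ]) r
  refine ⟨θ c, ?_, ?_⟩
  · rw [← hθ, hc', map_mul, mul_comm]
    simp [θ]
  · rw [← hθ, hc, map_mul, mul_comm]
    simp [θ]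

end FieldAction

end QuiverAction

section Slice

variable {K : Type*} [Field K] {n : ℕ} {V A : Type*} (s t : A → V) (ψ : V → A)

/-- The point `y` of `H` lies on the section `S`. -/
def InSlice {B : Type*} [CommRing B] (y : A → Matrix (Fin n) (Fin n) B) : Prop :=
  ∀ α, (α = ψ (t α) → LowerAnti (y α)) ∧ (s α ≠ t α → α = ψ (s α) → UpperAnti (y α))

theorem inSlice_iff {B : Type*} [CommRing B] (y : A → Matrix (Fin n) (Fin n) B) :
    InSlice s t ψ y ↔
      ∀ x : A × Fin n × Fin n, ¬ coordOK n s t ψ x → y x.1 x.2.1 x.2.2 = 0 := by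
  constructor
  · rintro h ⟨α, a, b⟩ hx
    obtain ⟨h1, h2⟩ := h α
    by_contra hne
    have h1' : α = ψ (t α) → n - 1 ≤ (a : ℕ) + b := fun hα => by
      by_contra hlt
      exact hne (h1 hα a b (not_le.1 hlt))
    have h2' : s α ≠ t α → α = ψ (s α) → (a : ℕ) + b ≤ n - 1 := fun hst hα => by
      by_contra hlt
      exact hne (h2 hst hα a b (not_le.1 hlt))
    refine hx ⟨fun hst hα => h1' ?_, fun hst => ⟨fun hα => h1' hα.1, fun hα => h2' hst hα.1,
      fun hα => le_antisymm (h2' hst hα.1) (h1' hα.2)⟩⟩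
    change s α = t α at hst
    change α = ψ (s α) at hα
    rwa [← hst]
  · intro h α
    refine ⟨fun hα a b hab => h (α, a, b) fun hx => ?_,
      fun hst hα a b hab => h (α, a, b) fun hx => ?_⟩
    · by_cases hst : s α = t α
      · have := hx.1 hst (by simpa [hst] using hα)
        simp only at this
        omega
      · by_cases hs : α = ψ (s α)
        · have := (hx.2 hst).2.2 ⟨hs, hα⟩
          simp only at this
          omega
        · have := (hx.2 hst).1 ⟨hα, hs⟩
          simp only at this
          omega
    · by_cases ht : α = ψ (t α)
      · have := (hx.2 hst).2.2 ⟨hα, ht⟩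
        simp only at this
        omega
      · have := (hx.2 hst).2.1 ⟨hα, ht⟩
        simp only at this
        omega

theorem coordOK_rev (α : A) (i : Fin n) : coordOK n s t ψ (α, i, i.rev) := by
  have h : (i : ℕ) + (i.rev : ℕ) = n - 1 := by
    rw [Fin.val_rev]
    omega
  exact ⟨fun _ _ => h.ge, fun _ => ⟨fun _ => h.ge, fun _ => h.le, fun _ => h⟩⟩

variable {s t ψ} in
/-- A unitriangular family moving a nondegenerate point of the section to a point of the section is
trivial. -/
theorem InSlice.eq_one (hψ : ∀ v : V, s (ψ v) = v ∨ t (ψ v) = v) {B : Type*} [CommRing B]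
    {g : V → Matrix (Fin n) (Fin n) B} (hg : ∀ v, IsUT (g v))
    {y : A → Matrix (Fin n) (Fin n) B} (hy : InSlice s t ψ y) (hu : ∀ α, IsUnit (y α))
    (hy' : InSlice s t ψ (actInv s t g y)) (v : V) : g v = 1 := by
  have hunit : ∀ v, IsUnit (g v) := fun v => (Matrix.isUnit_iff_isUnit_det _).2 (hg v).isUnit_det
  have hunit' : ∀ v, IsUnit (g v)⁻¹ :=
    fun v => (Matrix.isUnit_iff_isUnit_det _).2 (hg v).inv.isUnit_det
  by_cases ht : t (ψ v) = v
  · have hα : ψ v = ψ (t (ψ v)) := by rw [ht]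
    have h1 := ((hy (ψ v)).1 hα).mul_isUT (hg (s (ψ v)))
    have h2 := LowerAnti.eq_one_of_isUT_mul (hg v).inv h1 ((hy' (ψ v)).1 hα)
      ((hu _).mul (hunit _)) (by rw [actInv, ht, Matrix.mul_assoc])
    rw [← (hg v).inv_inv, h2, inv_one]
  · have hs : s (ψ v) = v := (hψ v).resolve_right ht
    have hst : s (ψ v) ≠ t (ψ v) := fun h => ht (h ▸ hs)
    have hα : ψ v = ψ (s (ψ v)) := by rw [hs]
    have h1 := ((hy (ψ v)).2 hst hα).isUT_mul (hg (t (ψ v))).inv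
    exact UpperAnti.eq_one_of_mul_isUT (hg v) h1 ((hy' (ψ v)).2 hst hα)
      ((hunit' _).mul (hu _)) (by rw [actInv, hs])

variable {s t ψ} in
/-- Over a ring with a map to a domain detecting units, a point whose image is a nondegenerate point
of the section can be moved to the section by a unitriangular family with trivial image. -/
theorem exists_actInv_inSlice (hψ : ∀ v : V, s (ψ v) = v ∨ t (ψ v) = v) {O k : Type*}
    [CommRing O] [CommRing k] [IsDomain k] (π : O →+* k) (hπ : ∀ x, π x ≠ 0 → IsUnit x)
    (y : A → Matrix (Fin n) (Fin n) O) (hy : InSlice s t ψ fun α => (y α).map π)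
    (hdiag : ∀ α i, π (y α i i.rev) ≠ 0) :
    ∃ g : V → Matrix (Fin n) (Fin n) O, (∀ v, IsUT (g v)) ∧ (∀ v, (g v).map π = 1) ∧
      InSlice s t ψ (actInv s t g y) := by
  have key : ∀ v, ∃ u : Matrix (Fin n) (Fin n) O, IsUT u ∧ u.map π = 1 ∧
      (t (ψ v) = v → LowerAnti (u⁻¹ * y (ψ v))) ∧
      (t (ψ v) ≠ v → UpperAnti (y (ψ v) * u)) := by
    intro v
    by_cases ht : t (ψ v) = v
    · obtain ⟨γ, h1, h2, h3⟩ := exists_isUT_mul_lowerAnti π hπ (y (ψ v))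
        ((hy (ψ v)).1 (by rw [ht])) (hdiag _)
      refine ⟨γ⁻¹, h1.inv, ?_, fun _ => by rwa [h1.inv_inv], fun h => absurd ht h⟩
      rw [← h1.map_inv, h3, inv_one]
    · have hs : s (ψ v) = v := (hψ v).resolve_right ht
      obtain ⟨δ, h1, h2, h3⟩ := exists_isUT_mul_upperAnti π hπ (y (ψ v))
        ((hy (ψ v)).2 (fun h => ht (h ▸ hs)) (by rw [hs])) (hdiag _)
      exact ⟨δ, h1, h3, fun h => absurd h ht, fun _ => h2⟩
  choose g hg hgπ hL hU using key
  refine ⟨g, hg, hgπ, fun α => ⟨fun hα => ?_, fun hst hα => ?_⟩⟩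
  · have := hL (t α)
    rw [← hα] at this
    exact (this rfl).mul_isUT (hg _)
  · have := hU (s α)
    rw [← hα] at this
    rw [actInv, Matrix.mul_assoc]
    exact (this hst.symm).isUT_mul (hg _).inv

variable {s t ψ} in
theorem evalAt_eq_aeval_resPoly {B : Type*} [CommRing B] [Algebra K B]
    {y : A → Matrix (Fin n) (Fin n) B} (hy : InSlice s t ψ y)
    {b : {x : A × Fin n × Fin n // coordOK n s t ψ x} → B}
    (hb : ∀ x, b x = y x.1.1 x.1.2.1 x.1.2.2) (p : MvPolynomial (A × Fin n × Fin n) K) :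
    evalAt y p = MvPolynomial.aeval b (resPoly K n s t ψ p) := by
  have : evalAt y = (MvPolynomial.aeval b).comp (resPoly K n s t ψ) := by
    ext x
    rw [evalAt_X, AlgHom.comp_apply, resPoly, MvPolynomial.aeval_X]
    by_cases hx : coordOK n s t ψ x
    · rw [dif_pos hx, MvPolynomial.aeval_X, hb]
    · rw [dif_neg hx, map_zero, (inSlice_iff s t ψ y).1 hy x hx]
  rw [this]
  rfl

variable {L : Type*} [Field L] [Algebra (MvPolynomial (A × Fin n × Fin n) K) L]
  [IsFractionRing (MvPolynomial (A × Fin n × Fin n) K) L]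

theorem isUnit_ratPoint (α : A) : IsUnit (ratPoint (K := K) (n := n) L α) := by
  rw [Matrix.isUnit_iff_isUnit_det, isUnit_iff_ne_zero, ratPoint, ← RingHom.mapMatrix_apply,
    ← RingHom.map_det]
  refine (map_ne_zero_iff _ (IsFractionRing.injective (MvPolynomial (A × Fin n × Fin n) K) L)).2
    fun h => ?_
  have h1 := congrArg (evalAt (K := K) fun _ : A => (1 : Matrix (Fin n) (Fin n) K)) h
  rw [map_zero, AlgHom.map_det] at h1
  have h2 : (evalAt (K := K) fun _ : A => (1 : Matrix (Fin n) (Fin n) K)).mapMatrix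
      (quiverPoint K n A α) = 1 := by
    ext i j
    simp [quiverPoint]
  rw [h2, Matrix.det_one] at h1
  exact one_ne_zero h1

variable [Algebra K L] [IsScalarTower K (MvPolynomial (A × Fin n × Fin n) K) L]

theorem map_fieldAct_ratPoint {g : V → Matrix (Fin n) (Fin n) K} (hg : ∀ v, IsUT (g v)) (α : A) :
    (ratPoint (K := K) L α).map (fieldAct K s t L hg) =
      actInv s t (fun v => (g v).map (algebraMap K L)) (ratPoint (K := K) L) α := by
  have h1 : (ratPoint (K := K) L α).map (fieldAct K s t L hg) =
      (actInv s t (fun v => (g v).map (algebraMap K (MvPolynomial (A × Fin n × Fin n) K)))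
        (quiverPoint K n A) α).map (algebraMap _ L) := by
    ext a b
    simp only [ratPoint, quiverPoint, Matrix.map_apply, Matrix.of_apply]
    rw [fieldAct_algebraMap, polyAct_eq_evalAt_actInv s t hg, evalAt_X]
  rw [h1, map_actInv s t _ (fun v => (hg v).map _)]
  have h2 : (fun v => ((g v).map (algebraMap K (MvPolynomial (A × Fin n × Fin n) K))).map
      (algebraMap _ L)) = fun v => (g v).map (algebraMap K L) := by
    funext v
    ext a b
    exact (IsScalarTower.algebraMap_apply K (MvPolynomial (A × Fin n × Fin n) K) L _).symm
  rw [h2]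
  rfl

variable {s t ψ} in
/-- The coordinates of the point of the section on the orbit of the generic point are invariant. -/
theorem isUInvariant_of_inSlice (hψ : ∀ v : V, s (ψ v) = v ∨ t (ψ v) = v)
    {γ : V → Matrix (Fin n) (Fin n) L} (hγ : ∀ v, IsUT (γ v))
    (hy : InSlice s t ψ (actInv s t γ (ratPoint (K := K) L))) (α : A) (a b : Fin n) :
    IsUInvariant K n s t L (actInv s t γ (ratPoint (K := K) L) α a b) := by
  rw [isUInvariant_iff_fieldAct]
  intro g hg
  set ρ := fieldAct K s t L hg with hρ
  set y := actInv s t γ (ratPoint (K := K) L) with hy_def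
  let e : V → Matrix (Fin n) (Fin n) L := fun v =>
    (γ v)⁻¹ * (g v).map (algebraMap K L) * (γ v).map ρ
  have he : ∀ v, IsUT (e v) := fun v =>
    ((hγ v).inv.mul ((hg v).map (algebraMap K L))).mul ((hγ v).map (ρ : L →+* L))
  have hmap : (fun α => (y α).map ρ) = actInv s t e y := by
    funext α
    have h1 := map_actInv s t (ρ : L →+* L) hγ (ratPoint (K := K) L) α
    refine h1.trans ?_
    have h2 : (fun α => (ratPoint (K := K) L α).map (ρ : L →+* L)) =
        actInv s t (fun v => (g v).map (algebraMap K L))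
          (actInv s t (fun v => (γ v)⁻¹) y) := by
      rw [hy_def, actInv_actInv_inv s t hγ]
      exact funext fun α => map_fieldAct_ratPoint s t hg α
    rw [h2]
    simp only [actInv, e, Matrix.mul_inv_rev, Matrix.mul_assoc]
    rfl
  have hslice : InSlice s t ψ (actInv s t e y) := by
    rw [inSlice_iff] at hy ⊢
    intro x hx
    rw [← hmap]
    simp [hy x hx]
  have hu : ∀ α, IsUnit (y α) := fun α =>
    (((Matrix.isUnit_iff_isUnit_det _).2 (hγ _).inv.isUnit_det).mul (isUnit_ratPoint α)).mul
      ((Matrix.isUnit_iff_isUnit_det _).2 (hγ _).isUnit_det)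
  have h1 := InSlice.eq_one hψ he hy hu hslice
  have h2 := congrFun (congrFun (congrFun hmap α) a) b
  simpa [actInv, h1] using h2

variable {s t ψ} in
variable (K L) in
/-- The generic point can be moved to the section by a unitriangular family whose coefficients are
regular along the section, and the resulting coordinates restrict to the coordinates of the
section. -/
theorem exists_slice_coordinates (hψ : ∀ v : V, s (ψ v) = v ∨ t (ψ v) = v) :
    ∃ (γ : V → Matrix (Fin n) (Fin n) L) (b : {x : A × Fin n × Fin n // coordOK n s t ψ x} → L),
      (∀ v, IsUT (γ v)) ∧ InSlice s t ψ (actInv s t γ (ratPoint (K := K) L)) ∧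
      (∀ x, b x = actInv s t γ (ratPoint (K := K) L) x.1.1 x.1.2.1 x.1.2.2) ∧
      ∀ P, ∃ p q : MvPolynomial (A × Fin n × Fin n) K, resPoly K n s t ψ q ≠ 0 ∧
        MvPolynomial.aeval b P * algebraMap _ L q = algebraMap _ L p ∧
        resPoly K n s t ψ p = P * resPoly K n s t ψ q := by
  classical
  let R := MvPolynomial (A × Fin n × Fin n) K
  let PS := MvPolynomial {x : A × Fin n × Fin n // coordOK n s t ψ x} K
  let I : Ideal R := RingHom.ker (resPoly K n s t ψ)
  have : I.IsPrime := RingHom.ker_isPrime _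
  let O := Localization.AtPrime I
  have hmem : ∀ q : I.primeCompl, resPoly K n s t ψ q ≠ 0 := fun q h => q.2 h
  let ι : O →ₐ[K] L := IsLocalization.liftAlgHom (M := I.primeCompl)
    (f := IsScalarTower.toAlgHom K R L) fun q => by
      refine isUnit_iff_ne_zero.2 ((map_ne_zero_iff _ (IsFractionRing.injective R L)).2 ?_)
      intro h
      exact hmem q (by rw [h, map_zero])
  let π : O →ₐ[K] FractionRing PS := IsLocalization.liftAlgHom (M := I.primeCompl)
    (f := (IsScalarTower.toAlgHom K PS (FractionRing PS)).comp (resPoly K n s t ψ)) fun q =>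
      isUnit_iff_ne_zero.2
        ((map_ne_zero_iff _ (IsFractionRing.injective PS (FractionRing PS))).2 (hmem q))
  have hι : ∀ r : R, ι (algebraMap R O r) = algebraMap R L r :=
    fun r => IsLocalization.lift_eq _ _
  have hπ : ∀ r : R, π (algebraMap R O r) = algebraMap PS _ (resPoly K n s t ψ r) :=
    fun r => IsLocalization.lift_eq _ _
  have hunit : ∀ x, π x ≠ 0 → IsUnit x := by
    intro x hx
    obtain ⟨⟨p, q⟩, hpq⟩ := IsLocalization.surj I.primeCompl x
    have h1 : p ∈ I.primeCompl := fun hp => by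
      have h2 := congrArg π hpq
      rw [map_mul, hπ, hπ, show resPoly K n s t ψ p = 0 from hp, map_zero] at h2
      exact (mul_ne_zero hx
        ((map_ne_zero_iff _ (IsFractionRing.injective PS (FractionRing PS))).2 (hmem q))) h2
    have h2 := IsLocalization.map_units O (⟨p, h1⟩ : I.primeCompl)
    rw [← hpq] at h2
    exact isUnit_of_mul_isUnit_left h2
  let y : A → Matrix (Fin n) (Fin n) O := fun α => (quiverPoint K n A α).map (algebraMap R O)
  have hyπ : ∀ x : A × Fin n × Fin n, π (y x.1 x.2.1 x.2.2) =
      algebraMap PS _ (if h : coordOK n s t ψ x then MvPolynomial.X ⟨x, h⟩ else 0) := by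
    intro x
    simp only [y, quiverPoint, Matrix.map_apply, Matrix.of_apply]
    rw [hπ, resPoly, MvPolynomial.aeval_X]
  have hy : InSlice s t ψ fun α => (y α).map (π : O →+* FractionRing PS) := by
    rw [inSlice_iff]
    intro x hx
    have := hyπ x
    rwa [dif_neg hx, map_zero] at this
  obtain ⟨g, hg, hgπ, hgy⟩ := exists_actInv_inSlice hψ (π : O →+* FractionRing PS) hunit y hy
    (fun α i => by
      have := hyπ (α, i, i.rev)
      rw [dif_pos (coordOK_rev s t ψ α i)] at this
      change π (y α i i.rev) ≠ 0
      rw [this]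
      exact (map_ne_zero_iff _ (IsFractionRing.injective PS (FractionRing PS))).2
        (MvPolynomial.X_ne_zero _))
  have hιy : ∀ α, (actInv s t g y α).map ι =
      actInv s t (fun v => (g v).map ι) (ratPoint (K := K) L) α := by
    intro α
    refine (map_actInv s t (ι : O →+* L) hg y α).trans ?_
    have : (fun α => (y α).map (ι : O →+* L)) = ratPoint (K := K) L := by
      funext α
      ext a b
      exact hι _
    rw [this]
    rfl
  have hπy : ∀ α, (actInv s t g y α).map π = (y α).map π := by
    intro α
    refine (map_actInv s t (π : O →+* FractionRing PS) hg y α).trans ?_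
    simp only [hgπ, actInv, inv_one, Matrix.one_mul, Matrix.mul_one]
    rfl
  let β : {x : A × Fin n × Fin n // coordOK n s t ψ x} → O :=
    fun x => actInv s t g y x.1.1 x.1.2.1 x.1.2.2
  refine ⟨fun v => (g v).map ι, fun x => ι (β x), fun v => (hg v).map (ι : O →+* L), ?_,
    fun x => ?_, fun P => ?_⟩
  · rw [inSlice_iff] at hgy ⊢
    intro x hx
    rw [← hιy, Matrix.map_apply, hgy x hx, map_zero]
  · rw [← hιy]
    rfl
  · obtain ⟨⟨p, q⟩, hpq⟩ := IsLocalization.surj I.primeCompl (MvPolynomial.aeval β P)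
    refine ⟨p, q, hmem q, ?_, ?_⟩
    · have h1 := congrArg ι hpq
      rw [map_mul, hι, hι, MvPolynomial.comp_aeval_apply] at h1
      exact h1
    · have h1 := congrArg π hpq
      rw [map_mul, hπ, hπ, MvPolynomial.comp_aeval_apply] at h1
      have h2 : (MvPolynomial.aeval fun x => π (β x)) =
          IsScalarTower.toAlgHom K PS (FractionRing PS) := by
        ext x
        have h3 := congrFun (congrFun (hπy x.1.1) x.1.2.1) x.1.2.2
        have h4 := hyπ x.1
        rw [dif_pos x.2] at h4
        rw [MvPolynomial.aeval_X]
        exact h3.trans h4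
      rw [h2] at h1
      apply IsFractionRing.injective PS (FractionRing PS)
      rw [map_mul]
      exact h1.symm

end Slice

/-- for infinite `K`: the restriction map
`π : K(H)^{U_Q} → K(S)` (injective) is an isomorphism of fields, and consequently
`K(H)^{U_Q}` is purely transcendental over `K` of transcendence degree `dim S`:
there is a family of invariants, indexed by the free coordinates of `S` (whose number
is `dim S = Σ_α dim S_α`), that is algebraically independent over `K` and generates the
field of invariants over `K`. Here `L` is a fraction field of the polynomial ring on `H`
(so `L ≅ K(H)`) and `LS` a fraction field of the polynomial ring on `S` (so `LS ≅ K(S)`). -/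
theorem restriction_isomorphism_and_purely_transcendental
    {K : Type*} [Field K] [Infinite K] {n : ℕ} (hn : 1 ≤ n)
    {V A : Type*} [Fintype V] [Fintype A] (s t : A → V) (ψ : V → A)
    (hψ : ∀ v : V, s (ψ v) = v ∨ t (ψ v) = v)
    (L : Type*) [Field L] [Algebra (MvPolynomial (A × Fin n × Fin n) K) L]
    [IsFractionRing (MvPolynomial (A × Fin n × Fin n) K) L]
    [Algebra K L] [IsScalarTower K (MvPolynomial (A × Fin n × Fin n) K) L]
    (LS : Type*) [Field LS]
    [Algebra (MvPolynomial {x : A × Fin n × Fin n // coordOK n s t ψ x} K) LS]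
    [IsFractionRing (MvPolynomial {x : A × Fin n × Fin n // coordOK n s t ψ x} K) LS] :
    -- π is defined on every invariant
    (∀ f : L, IsUInvariant K n s t L f → ∃ r : LS, resRel K n s t ψ L LS f r) ∧
    -- π is well defined (single-valued)
    (∀ (f : L) (r r' : LS), resRel K n s t ψ L LS f r → resRel K n s t ψ L LS f r' →
      r = r') ∧
    -- π is injective on invariants
    (∀ f f' : L, IsUInvariant K n s t L f → IsUInvariant K n s t L f' →
      ∀ r : LS, resRel K n s t ψ L LS f r → resRel K n s t ψ L LS f' r → f = f') ∧
    -- π is surjective onto K(S)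
    (∀ r : LS, ∃ f : L, IsUInvariant K n s t L f ∧ resRel K n s t ψ L LS f r) ∧
    -- K(H)^{U_Q} is purely transcendental over K of transcendence degree dim S
    (∃ b : {x : A × Fin n × Fin n // coordOK n s t ψ x} → L,
      (∀ x, IsUInvariant K n s t L (b x)) ∧
      AlgebraicIndependent K b ∧
      ∀ f : L, IsUInvariant K n s t L f ↔
        f ∈ IntermediateField.adjoin K (Set.range b)) := by
  classical
  let R := MvPolynomial (A × Fin n × Fin n) K
  let PS := MvPolynomial {x : A × Fin n × Fin n // coordOK n s t ψ x} K
  have hRL : Function.Injective (algebraMap R L) := IsFractionRing.injective R L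
  have hPS : Function.Injective (algebraMap PS LS) := IsFractionRing.injective PS LS
  have hPS0 : ∀ {P : PS}, P ≠ 0 → algebraMap PS LS P ≠ 0 := fun h => (map_ne_zero_iff _ hPS).2 h
  have hRL0 : ∀ {q : R}, q ≠ 0 → algebraMap R L q ≠ 0 := fun h => (map_ne_zero_iff _ hRL).2 h
  have hres0 : ∀ {q : R}, resPoly K n s t ψ q ≠ 0 → q ≠ 0 := by
    rintro q h rfl
    exact h (map_zero _)
  obtain ⟨γ, b, hγ, hslice, hb, hreg⟩ := exists_slice_coordinates (n := n) K L hψ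
  have hbinv : ∀ x, IsUInvariant K n s t L (b x) := fun x => by
    rw [hb]
    exact isUInvariant_of_inSlice hψ hγ hslice _ _ _
  have haeval_ne : ∀ Q : PS, Q ≠ 0 → MvPolynomial.aeval b Q ≠ 0 := by
    intro Q hQ h0
    obtain ⟨p, q, hq, h1, h2⟩ := hreg Q
    rw [h0, zero_mul] at h1
    have hp : p = 0 := hRL (by rw [← h1, map_zero])
    rw [hp, map_zero] at h2
    exact mul_ne_zero hQ hq h2.symm
  have hwell : ∀ (f : L) (r r' : LS), resRel K n s t ψ L LS f r → resRel K n s t ψ L LS f r' →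
      r = r' := by
    rintro f r r' ⟨p, q, -, h1, hq, h2⟩ ⟨p', q', -, h1', hq', h2'⟩
    have h3 : p * q' = p' * q := hRL (by
      rw [map_mul, map_mul, ← h1, ← h1']
      ring)
    have h4 := congrArg (fun z => algebraMap PS LS (resPoly K n s t ψ z)) h3
    simp only [map_mul] at h4
    rw [← h2, ← h2'] at h4
    have h5 : (r - r') * (algebraMap PS LS (resPoly K n s t ψ q) *
        algebraMap PS LS (resPoly K n s t ψ q')) = 0 := by
      linear_combination h4
    exact sub_eq_zero.1 ((mul_eq_zero.1 h5).resolve_right (mul_ne_zero (hPS0 hq) (hPS0 hq')))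
  have hnice : ∀ f : L, IsUInvariant K n s t L f → ∃ p q : R, q ≠ 0 ∧
      f * algebraMap R L q = algebraMap R L p ∧ resPoly K n s t ψ q ≠ 0 ∧
      f * MvPolynomial.aeval b (resPoly K n s t ψ q) =
        MvPolynomial.aeval b (resPoly K n s t ψ p) := by
    intro f hf
    obtain ⟨p, q, hq, hfpq, hsemi⟩ := hf.exists_semiInvariant
    obtain ⟨c, hcp, hcq⟩ := hsemi _ (fun v => (hγ v).inv) (actInv s t γ (ratPoint (K := K) L))
    rw [actInv_actInv_inv s t hγ, evalAt_eq_aeval_resPoly hslice hb] at hcp hcq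
    have hX : ∀ r : R, evalAt (ratPoint (K := K) L) r = algebraMap R L r := fun r =>
      evalAt_generic r
    rw [hX] at hcp hcq
    have hne := hRL0 hq
    rw [hcq] at hne
    refine ⟨p, q, hq, hfpq, fun h => ?_, ?_⟩
    · rw [h, map_zero, mul_zero] at hne
      exact hne rfl
    · rw [hcp, hcq] at hfpq
      refine mul_left_cancel₀ (left_ne_zero_of_mul hne) ?_
      rw [← hfpq]
      ring
  have hmem : ∀ P : PS, MvPolynomial.aeval b P ∈ IntermediateField.adjoin K (Set.range b) :=
    fun P => (IntermediateField.algebra_adjoin_le_adjoin K _) (by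
      rw [Algebra.adjoin_range_eq_range_aeval]
      exact ⟨P, rfl⟩)
  have hle : IntermediateField.adjoin K (Set.range b) ≤ invariantField (n := n) K s t L := by
    rw [IntermediateField.adjoin_le_iff]
    rintro _ ⟨x, rfl⟩
    exact hbinv x
  refine ⟨?_, hwell, ?_, ?_, b, hbinv, ?_, ?_⟩
  · intro f hf
    obtain ⟨p, q, hq, hfpq, hresq, -⟩ := hnice f hf
    exact ⟨algebraMap PS LS (resPoly K n s t ψ p) / algebraMap PS LS (resPoly K n s t ψ q),
      p, q, hq, hfpq, hresq, div_mul_cancel₀ _ (hPS0 hresq)⟩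
  · intro f f' hf hf' r hr hr'
    have key : ∀ f : L, IsUInvariant K n s t L f → resRel K n s t ψ L LS f r →
        ∃ P Q : PS, Q ≠ 0 ∧ r * algebraMap PS LS Q = algebraMap PS LS P ∧
          f * MvPolynomial.aeval b Q = MvPolynomial.aeval b P := by
      intro f hf hr
      obtain ⟨p, q, hq, hfpq, hresq, hfb⟩ := hnice f hf
      refine ⟨_, _, hresq, ?_, hfb⟩
      rw [hwell f r _ hr ⟨p, q, hq, hfpq, hresq, div_mul_cancel₀ _ (hPS0 hresq)⟩,
        div_mul_cancel₀ _ (hPS0 hresq)]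
    obtain ⟨P, Q, hQ, h1, h2⟩ := key f hf hr
    obtain ⟨P', Q', hQ', h1', h2'⟩ := key f' hf' hr'
    have h3 : P * Q' = P' * Q := hPS (by
      rw [map_mul, map_mul, ← h1, ← h1']
      ring)
    have h4 := congrArg (MvPolynomial.aeval b) h3
    rw [map_mul, map_mul, ← h2, ← h2'] at h4
    have h5 : (f - f') * (MvPolynomial.aeval b Q * MvPolynomial.aeval b Q') = 0 := by
      linear_combination h4
    exact sub_eq_zero.1 ((mul_eq_zero.1 h5).resolve_right
      (mul_ne_zero (haeval_ne Q hQ) (haeval_ne Q' hQ')))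
  · intro r
    obtain ⟨P, Q, hQ, rfl⟩ := IsFractionRing.div_surjective (A := PS) r
    have hQ0 : Q ≠ 0 := nonZeroDivisors.ne_zero hQ
    refine ⟨MvPolynomial.aeval b P / MvPolynomial.aeval b Q, hle (div_mem (hmem P) (hmem Q)), ?_⟩
    obtain ⟨p, q, hq, h1, h2⟩ := hreg P
    obtain ⟨p', q', hq', h1', h2'⟩ := hreg Q
    have hden : resPoly K n s t ψ (q * p') ≠ 0 := by
      rw [map_mul, h2']
      exact mul_ne_zero hq (mul_ne_zero hQ0 hq')
    have hbQ := haeval_ne Q hQ0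
    have hQL := hPS0 hQ0
    refine ⟨p * q', q * p', hres0 hden, ?_, hden, ?_⟩
    · rw [map_mul, map_mul, ← h1, ← h1']
      field_simp
    · rw [map_mul (resPoly K n s t ψ), map_mul (resPoly K n s t ψ) p, h2, h2',
        div_mul_eq_mul_div, div_eq_iff hQL]
      refine (map_mul (algebraMap PS LS) _ _).symm.trans (.trans (congrArg _ ?_) (map_mul _ _ _))
      ring
  · rw [AlgebraicIndependent, injective_iff_map_eq_zero]
    exact fun P hP => by_contra fun h => haeval_ne P h hP
  · intro f
    constructor
    · intro hf
      obtain ⟨p, q, -, -, hresq, hfb⟩ := hnice f hf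
      rw [eq_div_of_mul_eq (haeval_ne _ hresq) hfb]
      exact div_mem (hmem _) (hmem _)
    · exact fun hf => hle hf
end
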